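/- Let Σ ⊂ ℝ⁴ be a compact connected hypersurface, and suppose there exists a smooth function φ : ℝ⁴ → ℝ such that (1) Σ = φ⁻¹(0) and 0 is a regular value of φ, (2) W = {z : φ(z) ≤ 0} is bounded, and (3) D²φ(z)(h,h) > 0 for every z ∈ W and every nonzero h ∈ ℝ⁴. Then Σ bounds a strongly convex domain, i.e., there exist δ > 0 and a smooth convex function C : ℝ⁴ → ℝ with Σ = C⁻¹(1) and D²C(z) - δ·Id positive definite for all z ∈ ℝ⁴. -/

import Mathlib

section Helpers

variable {E : Type*} [NormedAddCommGroup E] [InnerProductSpace ℝ E]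

/-- Second derivative of `f` at `z` in direction `h`. -/
noncomputable abbrev hess (f : E → ℝ) (z h : E) : ℝ := fderiv ℝ (fderiv ℝ f) z h h

lemma contDiff_fd {f : E → ℝ} (hf : ContDiff ℝ (⊤ : ℕ∞) f) :
    ContDiff ℝ (⊤ : ℕ∞) (fderiv ℝ f) :=
  hf.fderiv_right (by simp)

lemma line_hasDerivAt (z h : E) (t : ℝ) : HasDerivAt (fun s : ℝ => z + s • h) h t := by
  simpa using ((hasDerivAt_id t).smul_const h).const_add z

lemma line_deriv1 {f : E → ℝ} (hf : ContDiff ℝ (⊤ : ℕ∞) f) (z h : E) (t : ℝ) :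
    HasDerivAt (fun s : ℝ => f (z + s • h)) (fderiv ℝ f (z + t • h) h) t :=
  ((hf.differentiable (by simp)) (z + t • h)).hasFDerivAt.comp_hasDerivAt t
    (line_hasDerivAt z h t)

lemma line_deriv2 {f : E → ℝ} (hf : ContDiff ℝ (⊤ : ℕ∞) f) (z h : E) (t : ℝ) :
    HasDerivAt (fun s : ℝ => fderiv ℝ f (z + s • h) h) (hess f (z + t • h) h) t := by
  have := (((contDiff_fd hf).differentiable (by simp)) (z + t • h)).hasFDerivAt.comp_hasDerivAt t
    (line_hasDerivAt z h t)
  simpa using this.clm_apply (hasDerivAt_const t h)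

lemma hess_eq {f : E → ℝ} (hf : ContDiff ℝ (⊤ : ℕ∞) f) (z h : E) {g g' : ℝ → ℝ} {c : ℝ}
    (hg : ∀ t, f (z + t • h) = g t) (h1 : ∀ t, HasDerivAt g (g' t) t)
    (h2 : HasDerivAt g' c 0) : hess f z h = c := by
  have e : (fun s : ℝ => fderiv ℝ f (z + s • h) h) = g' := by
    funext t
    have a := line_deriv1 hf z h t
    have : (fun s : ℝ => f (z + s • h)) = g := funext hg
    rw [this] at a
    exact a.unique (h1 t)
  have a := line_deriv2 hf z h 0
  rw [e] at a
  simpa using a.unique h2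

lemma hess_add {f g : E → ℝ} (hf : ContDiff ℝ (⊤ : ℕ∞) f) (hg : ContDiff ℝ (⊤ : ℕ∞) g)
    (a b : ℝ) (z h : E) :
    hess (fun x => a + f x + b * g x) z h = hess f z h + b * hess g z h := by
  have hs : ContDiff ℝ (⊤ : ℕ∞) (fun x => a + f x + b * g x) := by fun_prop
  refine hess_eq hs z h (fun t => rfl)
    (fun t => ((line_deriv1 hf z h t).const_add a).add ((line_deriv1 hg z h t).const_mul b)) ?_
  refine ((line_deriv2 hf z h 0).add ((line_deriv2 hg z h 0).const_mul b)).congr_deriv ?_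
  simp

lemma segment_convex {f : E → ℝ} (hf : ContDiff ℝ (⊤ : ℕ∞) f) (x v : E)
    (hp : ∀ t ∈ Set.Icc (0 : ℝ) 1, 0 ≤ hess f (x + t • v) v) :
    ConvexOn ℝ (Set.Icc (0 : ℝ) 1) (fun t : ℝ => f (x + t • v)) := by
  refine convexOn_of_hasDerivWithinAt2_nonneg (convex_Icc 0 1) ?_
    (fun t _ => (line_deriv1 hf x v t).hasDerivWithinAt)
    (fun t _ => (line_deriv2 hf x v t).hasDerivWithinAt)
    (fun t ht => hp t (interior_subset ht))
  exact fun t _ => (line_deriv1 hf x v t).continuousAt.continuousWithinAt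

lemma segment_le {f : E → ℝ} (hf : ContDiff ℝ (⊤ : ℕ∞) f) (x v : E)
    (hp : ∀ t ∈ Set.Icc (0 : ℝ) 1, 0 ≤ hess f (x + t • v) v) {t : ℝ}
    (ht : t ∈ Set.Icc (0 : ℝ) 1) :
    f (x + t • v) ≤ (1 - t) * f x + t * f (x + v) := by
  have := (segment_convex hf x v hp).2 (Set.left_mem_Icc.2 zero_le_one)
    (Set.right_mem_Icc.2 zero_le_one) (sub_nonneg.2 ht.2) ht.1 (sub_add_cancel 1 t)
  simpa using this

lemma convexOn_of_hess {f : E → ℝ} (hf : ContDiff ℝ (⊤ : ℕ∞) f)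
    (hp : ∀ z h, 0 ≤ hess f z h) : ConvexOn ℝ Set.univ f := by
  refine ⟨convex_univ, fun x _ y _ a b ha hb hab => ?_⟩
  have := segment_le hf x (y - x) (fun t _ => hp _ _) (t := b) ⟨hb, by linarith⟩
  have e : a • x + b • y = x + b • (y - x) := by
    obtain rfl : a = 1 - b := by linarith
    module
  rw [e]
  obtain rfl : a = 1 - b := by linarith
  simpa using this

/-- Openness of the set where a condition holds uniformly over a compact set. -/
lemma isOpen_forall_compact {X Y : Type*} [TopologicalSpace X] [TopologicalSpace Y] {K : Set Y}
    (hK : IsCompact K) {O : Set (X × Y)} (hO : IsOpen O) :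
    IsOpen {x | ∀ y ∈ K, (x, y) ∈ O} := by
  rw [isOpen_iff_mem_nhds]
  intro x hx
  exact hK.eventually_forall_of_forall_eventually (P := fun x y => (x, y) ∈ O)
    (fun y hy => hO.mem_nhds (hx y hy))

lemma continuous_hess {f : E → ℝ} (hf : ContDiff ℝ (⊤ : ℕ∞) f) :
    Continuous (fun p : E × E => hess f p.1 p.2) := by
  have := (contDiff_fd (E := E) hf)
  have h2 : Continuous (fderiv ℝ (fderiv ℝ f)) := this.continuous_fderiv (by simp)
  unfold hess
  fun_prop

/-- Homogeneity: a lower bound on the unit sphere gives a quadratic lower bound. -/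
lemma hess_lower {f : E → ℝ} {z : E} {m : ℝ}
    (hm : ∀ h ∈ Metric.sphere (0 : E) 1, m < hess f z h) (h : E) :
    m * ‖h‖ ^ 2 ≤ hess f z h := by
  rcases eq_or_ne h 0 with rfl | h0
  · simp [hess]
  have hn : 0 < ‖h‖ := norm_pos_iff.2 h0
  have := hm (‖h‖⁻¹ • h) (by simp [norm_smul, hn.ne'])
  have e : hess f z h = ‖h‖ ^ 2 * hess f z (‖h‖⁻¹ • h) := by
    simp only [hess, map_smul, smul_apply, smul_eq_mul]
    field_simp
  rw [e]
  nlinarith [sq_nonneg ‖h‖]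

/-- A sublevel set containing its boundary-connecting segments is preconnected. -/
lemma sublevel_preconnected {φ : E → ℝ} (hφ : Continuous φ) (hS : IsConnected (φ ⁻¹' {0}))
    (hb : Bornology.IsBounded {z | φ z ≤ 0}) (v : E) (hv : v ≠ 0) :
    IsPreconnected {z | φ z ≤ 0} := by
  obtain ⟨x, hx⟩ := hS.nonempty
  refine isPreconnected_of_forall x fun y hy => ?_
  obtain ⟨R, hR⟩ := hb.subset_closedBall y
  have hv' : 0 < ‖v‖ := norm_pos_iff.2 hv
  set g : ℝ → ℝ := fun t => φ (y + t • v) with hg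
  have hgc : Continuous g := by fun_prop
  set A : Set ℝ := {t | 0 ≤ t ∧ 0 ≤ g t} with hA
  have hAc : IsClosed A :=
    (isClosed_le continuous_const continuous_id).inter (isClosed_le continuous_const hgc)
  have hAn : A.Nonempty := by
    refine ⟨(|R| + 1) / ‖v‖, by positivity, ?_⟩
    by_contra hcon
    have h1 := hR (show y + ((|R| + 1) / ‖v‖) • v ∈ {z | φ z ≤ 0} from (not_le.1 hcon).le)
    rw [mem_closedBall_iff_norm, add_sub_cancel_left, norm_smul, Real.norm_eq_abs,
      abs_of_pos (by positivity), div_mul_cancel₀ _ hv'.ne'] at h1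
    linarith [le_abs_self R]
  have hAb : BddBelow A := ⟨0, fun t ht => ht.1⟩
  set τ := sInf A with hτ
  have hτA : τ ∈ A := hAc.csInf_mem hAn hAb
  have hle : ∀ t ∈ Set.Icc 0 τ, g t ≤ 0 := by
    intro t ht
    by_contra hcon
    have hcon := not_le.1 hcon
    have htτ : t = τ := le_antisymm ht.2 (csInf_le hAb ⟨ht.1, hcon.le⟩)
    have hg0 : g 0 ≤ 0 := by simpa [hg] using hy
    obtain ⟨s, hs, hs0⟩ := intermediate_value_Icc ht.1 hgc.continuousOn ⟨hg0, hcon.le⟩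
    have : τ ≤ s := csInf_le hAb ⟨hs.1, hs0.ge⟩
    have : s = t := le_antisymm hs.2 (htτ ▸ this)
    subst this
    linarith
  refine ⟨φ ⁻¹' {0} ∪ (fun t : ℝ => y + t • v) '' Set.Icc 0 τ, ?_, Or.inl hx, Or.inr ⟨0, ?_, ?_⟩, ?_⟩
  · rintro z (hz | ⟨t, ht, rfl⟩)
    · exact le_of_eq hz
    · exact hle t ht
  · exact ⟨le_rfl, hτA.1⟩
  · simp
  · refine IsPreconnected.union (y + τ • v) ?_ ?_ hS.isPreconnected
      (isPreconnected_Icc.image _ (by fun_prop))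
    · exact le_antisymm (hle τ ⟨hτA.1, le_rfl⟩) hτA.2
    · exact ⟨τ, ⟨hτA.1, le_rfl⟩, rfl⟩

/-- Connected plus locally convex implies convex. -/
lemma sublevel_convex {φ : E → ℝ} (hφ : ContDiff ℝ (⊤ : ℕ∞) φ)
    (hW : IsPreconnected {z | φ z ≤ 0}) {V : Set E} (hV : IsOpen V)
    (hWV : {z | φ z ≤ 0} ⊆ V) (hp : ∀ z ∈ V, ∀ h, 0 ≤ hess φ z h) :
    Convex ℝ {z | φ z ≤ 0} := by
  set W : Set E := {z | φ z ≤ 0} with hWd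
  have hcl : IsClosed W := isClosed_le hφ.continuous continuous_const
  have hl : Continuous (fun q : (E × E) × ℝ => q.1.1 + q.2 • (q.1.2 - q.1.1)) := by fun_prop
  set T : Set (E × E) := {p | ∀ t ∈ Set.Icc (0 : ℝ) 1, p.1 + t • (p.2 - p.1) ∈ V} with hT
  set F : Set (E × E) := {p | ∀ t ∈ Set.Icc (0 : ℝ) 1, p.1 + t • (p.2 - p.1) ∈ W} with hF
  have hTo : IsOpen T := isOpen_forall_compact isCompact_Icc (hV.preimage hl)
  have hFc : IsClosed F := by
    have : F = ⋂ t ∈ Set.Icc (0 : ℝ) 1, {p : E × E | p.1 + t • (p.2 - p.1) ∈ W} := by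
      ext p; simp [hF]
    rw [this]
    exact isClosed_biInter fun t _ => hcl.preimage (by fun_prop)
  have hTF : ∀ p ∈ W ×ˢ W, p ∈ T → p ∈ F := by
    rintro ⟨x, y⟩ ⟨hx, hy⟩ hpT t ht
    have := segment_le hφ x (y - x) (fun s hs => hp _ (hpT s hs) _) ht
    simp only [add_sub_cancel] at this
    simp only [hWd, Set.mem_ofPred_eq] at hx hy ⊢
    nlinarith [ht.1, ht.2]
  have hFT : F ⊆ T := fun p hpF t ht => hWV (hpF t ht)
  have key : ∀ p ∈ W ×ˢ W, p ∈ F := by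
    intro p hpW
    by_contra hcon
    obtain ⟨q, hq, hqT, hqF⟩ := (hW.prod hW) T Fᶜ hTo hFc.isOpen_compl
      (fun q _ => by
        by_cases hq : q ∈ F
        · exact Or.inl (hFT hq)
        · exact Or.inr hq)
      ⟨(p.1, p.1), ⟨hpW.1, hpW.1⟩, fun t _ => by simpa using hWV hpW.1⟩ ⟨p, hpW, hcon⟩
    exact hqF (hTF q hq hqT)
  intro x hx y hy a b ha hb hab
  have := key (x, y) ⟨hx, hy⟩ b ⟨hb, by linarith⟩
  have e : a • x + b • y = x + b • (y - x) := by
    obtain rfl : a = 1 - b := by linarith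
    module
  rw [e]
  exact this

/-- A smooth convex ramp. -/
noncomputable def ramp (t : ℝ) : ℝ := ∫ s in (0 : ℝ)..t, Real.smoothTransition s

lemma ramp_hasDerivAt (t : ℝ) : HasDerivAt ramp (Real.smoothTransition t) t :=
  intervalIntegral.integral_hasDerivAt_right
    (Real.smoothTransition.continuous.intervalIntegrable _ _)
    (Real.smoothTransition.continuous.stronglyMeasurableAtFilter _ _)
    Real.smoothTransition.continuousAt

lemma ramp_contDiff : ContDiff ℝ (⊤ : ℕ∞) ramp := by
  rw [contDiff_infty_iff_deriv]
  refine ⟨fun t => (ramp_hasDerivAt t).differentiableAt, ?_⟩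
  have : deriv ramp = Real.smoothTransition := funext fun t => (ramp_hasDerivAt t).deriv
  rw [this]
  exact Real.smoothTransition.contDiff

lemma ramp_mono : Monotone ramp :=
  monotone_of_hasDerivAt_nonneg ramp_hasDerivAt Real.smoothTransition.nonneg

lemma ramp_zero {t : ℝ} (ht : t ≤ 0) : ramp t = 0 := by
  unfold ramp
  rw [intervalIntegral.integral_congr (g := fun _ => 0)]
  · simp
  · intro s hs
    rw [Set.uIcc_of_ge ht] at hs
    exact Real.smoothTransition.zero_of_nonpos hs.2

lemma ramp_nonneg (t : ℝ) : 0 ≤ ramp t := by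
  rcases le_total t 0 with h | h
  · exact (ramp_zero h).ge
  · rw [← ramp_zero le_rfl]; exact ramp_mono h

lemma ramp_pos {t : ℝ} (ht : 0 < t) : 0 < ramp t :=
  intervalIntegral.intervalIntegral_pos_of_pos_on
    (Real.smoothTransition.continuous.intervalIntegrable _ _)
    (fun _ hs => Real.smoothTransition.pos_of_pos hs.1) ht

/-- There is a smooth convex nonnegative function vanishing on `W` which is uniformly strongly
convex and positive on `K`. -/
def Barrier (W K : Set E) : Prop :=
  ∃ ψ : E → ℝ, ∃ c > (0 : ℝ), ContDiff ℝ (⊤ : ℕ∞) ψ ∧ (∀ z h, 0 ≤ hess ψ z h) ∧ (∀ z, 0 ≤ ψ z) ∧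
    (∀ z ∈ W, ψ z = 0) ∧ (∀ z ∈ K, 0 < ψ z) ∧ ∀ z ∈ K, ∀ h, c * ‖h‖ ^ 2 ≤ hess ψ z h

lemma Barrier.mono {W K K' : Set E} (hK : K ⊆ K') (h : Barrier W K') : Barrier W K := by
  obtain ⟨ψ, c, hc, h1, h2, h3, h4, h5, h6⟩ := h
  exact ⟨ψ, c, hc, h1, h2, h3, h4, fun z hz => h5 z (hK hz), fun z hz => h6 z (hK hz)⟩

lemma Barrier.union {W K K' : Set E} (h : Barrier W K) (h' : Barrier W K') :
    Barrier W (K ∪ K') := by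
  obtain ⟨ψ, c, hc, h1, h2, h3, h4, h5, h6⟩ := h
  obtain ⟨ψ', c', hc', h1', h2', h3', h4', h5', h6'⟩ := h'
  refine ⟨fun x => 0 + ψ x + 1 * ψ' x, min c c', lt_min hc hc', by fun_prop, ?_, ?_, ?_, ?_, ?_⟩
  · intro z h
    rw [hess_add h1 h1']
    linarith [h2 z h, h2' z h]
  · intro z
    linarith [h3 z, h3' z]
  · intro z hz
    simp [h4 z hz, h4' z hz]
  · rintro z (hz | hz)
    · linarith [h5 z hz, h3' z]
    · linarith [h5' z hz, h3 z]
  · intro z hz h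
    rw [hess_add h1 h1']
    have n := sq_nonneg ‖h‖
    rcases hz with hz | hz
    · have := mul_le_mul_of_nonneg_right (min_le_left c c') n
      linarith [h6 z hz h, h2' z h]
    · have := mul_le_mul_of_nonneg_right (min_le_right c c') n
      linarith [h6' z hz h, h2 z h]

lemma barrier_quadratic {W : Set E} (L : E →L[ℝ] ℝ) {a : ℝ} (ha : 0 < a) (b : ℝ)
    (hW : ∀ z ∈ W, L z + a * ‖z‖ ^ 2 - b ≤ 0) :
    Barrier W {z | 1 ≤ L z + a * ‖z‖ ^ 2 - b} := by
  have hs : ContDiff ℝ (⊤ : ℕ∞) (fun z : E => ramp (L z + a * ‖z‖ ^ 2 - b)) := by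
    refine ramp_contDiff.comp ?_
    have := contDiff_norm_sq ℝ (E := E) (n := (⊤ : ℕ∞))
    have := L.contDiff (n := (⊤ : ℕ∞))
    fun_prop
  have hh : ∀ z h : E, hess (fun z : E => ramp (L z + a * ‖z‖ ^ 2 - b)) z h =
      deriv Real.smoothTransition (L z + a * ‖z‖ ^ 2 - b) * (L h + 2 * a * inner ℝ z h) ^ 2
        + Real.smoothTransition (L z + a * ‖z‖ ^ 2 - b) * (2 * a * ‖h‖ ^ 2) := by
    intro z h
    set α := L z + a * ‖z‖ ^ 2 - b with hα
    set β := L h + 2 * a * inner ℝ z h with hβ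
    set γ := a * ‖h‖ ^ 2 with hγ
    have hq : ∀ t : ℝ, HasDerivAt (fun t : ℝ => α + β * t + γ * t ^ 2) (β + 2 * γ * t) t := by
      intro t
      have := (((hasDerivAt_id t).const_mul β).const_add α).add
        ((hasDerivAt_pow 2 t).const_mul γ)
      refine this.congr_deriv ?_
      simp; ring
    refine hess_eq hs z h (g := fun t => ramp (α + β * t + γ * t ^ 2)) (g' := fun t =>
      Real.smoothTransition (α + β * t + γ * t ^ 2) * (β + 2 * γ * t)) ?_ ?_ ?_
    · intro t
      congr 1
      rw [norm_add_sq_real, map_add, map_smul, norm_smul, inner_smul_right, mul_pow,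
        Real.norm_eq_abs, sq_abs, smul_eq_mul]
      simp only [hα, hβ, hγ]
      ring
    · intro t
      exact (ramp_hasDerivAt _).comp t (hq t)
    · have hd : DifferentiableAt ℝ Real.smoothTransition α :=
        (Real.smoothTransition.contDiff (n := 1)).differentiable (by simp) α
      have e : α + β * 0 + γ * 0 ^ 2 = α := by ring
      have d1 := HasDerivAt.comp (h₂ := Real.smoothTransition)
        (h₂' := deriv Real.smoothTransition α) 0 (by rw [e]; exact hd.hasDerivAt) (hq 0)
      have d2 : HasDerivAt (fun t : ℝ => β + 2 * γ * t) (2 * γ) 0 := by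
        simpa using ((hasDerivAt_id (0 : ℝ)).const_mul (2 * γ)).const_add β
      refine (d1.mul d2).congr_deriv ?_
      simp [hγ]; ring
  have hd0 : ∀ t, 0 ≤ deriv Real.smoothTransition t := fun t =>
    Real.smoothTransition.monotone.deriv_nonneg
  refine ⟨_, 2 * a, by positivity, hs, ?_, fun z => ramp_nonneg _, fun z hz => ramp_zero (hW z hz),
    fun z hz => ramp_pos (lt_of_lt_of_le one_pos hz), ?_⟩
  · intro z h
    rw [hh]
    have := hd0 (L z + a * ‖z‖ ^ 2 - b)
    have := Real.smoothTransition.nonneg (L z + a * ‖z‖ ^ 2 - b)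
    positivity
  · intro z hz h
    rw [hh, Real.smoothTransition.one_of_one_le hz]
    have := mul_nonneg (hd0 (L z + a * ‖z‖ ^ 2 - b)) (sq_nonneg (L h + 2 * a * inner ℝ z h))
    linarith

lemma barrier_compl [FiniteDimensional ℝ E] {W V : Set E} (hWc : IsClosed W) (hWx : Convex ℝ W)
    {R : ℝ} (hR : 0 < R) (hWR : ∀ z ∈ W, ‖z‖ ≤ R) (hV : IsOpen V) (hWV : W ⊆ V) :
    Barrier W Vᶜ := by
  have hfar : Barrier W {z : E | 1 ≤ (0 : E →L[ℝ] ℝ) z + 1 * ‖z‖ ^ 2 - R ^ 2} := by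
    refine barrier_quadratic 0 one_pos _ fun z hz => ?_
    have := hWR z hz
    have := norm_nonneg z
    simp only [zero_apply]
    nlinarith
  have hnear : Barrier W (Metric.closedBall (0 : E) (R + 1) ∩ Vᶜ) := by
    have hK : IsCompact (Metric.closedBall (0 : E) (R + 1) ∩ Vᶜ) :=
      (isCompact_closedBall _ _).inter_right hV.isClosed_compl
    refine hK.induction_on (p := fun K => Barrier W K) ?_ (fun s t hst => Barrier.mono hst)
      (fun s t => Barrier.union) ?_
    · exact hfar.mono (Set.empty_subset _)
    · intro x hx
      obtain ⟨f, u, hfu, hux⟩ := geometric_hahn_banach_closed_point hWx hWc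
        (fun h => hx.2 (hWV h))
      set d := f x - u with hd
      have hd0 : 0 < d := by simp only [hd]; linarith
      -- the quadratic is (4/d) * (f z - u + a (‖z‖^2 - R^2)) with a = d / (2 R^2)
      refine ⟨{z | 1 ≤ ((4 / d) • f) z + (2 / R ^ 2) * ‖z‖ ^ 2 - (4 / d * u + 2)}, ?_, ?_⟩
      · refine mem_nhdsWithin_of_mem_nhds ?_
        have hc : Continuous fun z : E =>
            ((4 / d) • f) z + (2 / R ^ 2) * ‖z‖ ^ 2 - (4 / d * u + 2) := by fun_prop
        have hlt : 1 < ((4 / d) • f) x + (2 / R ^ 2) * ‖x‖ ^ 2 - (4 / d * u + 2) := by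
          have e : ((4 / d) • f) x - 4 / d * u = 4 := by
            simp only [smul_apply, smul_eq_mul]
            rw [← mul_sub, ← hd]; field_simp
          have : 0 ≤ (2 / R ^ 2) * ‖x‖ ^ 2 := by positivity
          linarith
        filter_upwards [hc.continuousAt.eventually (lt_mem_nhds hlt)] with z hz
        exact hz.le
      · refine barrier_quadratic _ (by positivity) _ fun z hz => ?_
        have h1 : (4 / d) * f z ≤ 4 / d * u :=
          mul_le_mul_of_nonneg_left (hfu z hz).le (by positivity)
        have h2 : (2 / R ^ 2) * ‖z‖ ^ 2 ≤ 2 := by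
          rw [div_mul_eq_mul_div, div_le_iff₀ (by positivity)]
          have := hWR z hz
          have := norm_nonneg z
          nlinarith
        simp only [smul_apply, smul_eq_mul]
        linarith
  refine (hnear.union hfar).mono fun z hz => ?_
  by_cases h : ‖z‖ ≤ R + 1
  · exact Or.inl ⟨by simpa using h, hz⟩
  · right
    have h := not_le.1 h
    simp only [Set.mem_ofPred_eq, zero_apply]
    nlinarith

lemma hess_bound {G : E → ℝ} (hG : ContDiff ℝ (⊤ : ℕ∞) G) (hGs : HasCompactSupport G) :
    ∃ M : ℝ, 0 ≤ M ∧ ∀ z h, -(M * ‖h‖ ^ 2) ≤ hess G z h := by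
  have hcont : Continuous (fderiv ℝ (fderiv ℝ G)) :=
    (contDiff_fd hG).continuous_fderiv (by simp)
  obtain ⟨M, hM⟩ := IsCompact.exists_bound_of_continuousOn (f := fderiv ℝ (fderiv ℝ G))
    (show IsCompact (tsupport G) from hGs) hcont.continuousOn
  refine ⟨|M|, abs_nonneg M, fun z h => ?_⟩
  by_cases hz : z ∈ tsupport G
  swap
  · have e : G =ᶠ[nhds z] fun _ => (0 : ℝ) := notMem_tsupport_iff_eventuallyEq.1 hz
    have h0 : hess G z h = 0 := by
      simp only [hess]
      rw [e.fderiv.fderiv_eq]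
      simp
    rw [h0]
    have : 0 ≤ |M| * ‖h‖ ^ 2 := by positivity
    linarith
  have h1 : ‖fderiv ℝ (fderiv ℝ G) z h h‖ ≤ ‖fderiv ℝ (fderiv ℝ G) z‖ * ‖h‖ * ‖h‖ :=
    ContinuousLinearMap.le_opNorm₂ _ h h
  have h2 : ‖fderiv ℝ (fderiv ℝ G) z‖ * ‖h‖ * ‖h‖ ≤ |M| * ‖h‖ ^ 2 := by
    rw [mul_assoc, ← sq]
    exact mul_le_mul_of_nonneg_right ((hM z hz).trans (le_abs_self M)) (sq_nonneg _)
  rw [Real.norm_eq_abs] at h1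
  exact (abs_le.1 (h1.trans h2)).1

lemma main_aux [FiniteDimensional ℝ E] [Nontrivial E] {φ : E → ℝ} (hφ : ContDiff ℝ (⊤ : ℕ∞) φ)
    (hSconn : IsConnected (φ ⁻¹' {0}))
    (hbdd : Bornology.IsBounded {z | φ z ≤ 0})
    (hconv : ∀ z, φ z ≤ 0 → ∀ h : E, h ≠ 0 → 0 < hess φ z h) :
    ∃ δ > (0 : ℝ), ∃ C : E → ℝ,
      ContDiff ℝ (⊤ : ℕ∞) C ∧ ConvexOn ℝ Set.univ C ∧ φ ⁻¹' {0} = C ⁻¹' {1} ∧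
      ∀ z, ∀ h : E, h ≠ 0 → δ * ‖h‖ ^ 2 < hess C z h := by
  set W : Set (E) := {z | φ z ≤ 0} with hWd
  have hWcl : IsClosed W := isClosed_le hφ.continuous continuous_const
  have hWc : IsCompact W := Metric.isCompact_of_isClosed_isBounded hWcl hbdd
  obtain ⟨z₀, hz₀⟩ := hSconn.nonempty
  have hz₀W : z₀ ∈ W := le_of_eq hz₀
  obtain ⟨v, hv⟩ := exists_ne (0 : E)
  have hWpre : IsPreconnected W := sublevel_preconnected hφ.continuous hSconn hbdd v hv
  have hsph : IsCompact (Metric.sphere (0 : E) 1) := isCompact_sphere _ _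
  have hsne : (Metric.sphere (0 : E) 1).Nonempty :=
    NormedSpace.sphere_nonempty.2 zero_le_one
  -- uniform lower bound of the Hessian on `W`
  obtain ⟨m, hm0, hm⟩ : ∃ m > (0 : ℝ), ∀ z ∈ W,
      ∀ h ∈ Metric.sphere (0 : E) 1, m < hess φ z h := by
    obtain ⟨p, hp, hmin⟩ := (hWc.prod hsph).exists_isMinOn
      (Set.Nonempty.prod ⟨z₀, hz₀W⟩ hsne) (continuous_hess hφ).continuousOn
    have hp0 : 0 < hess φ p.1 p.2 := hconv p.1 hp.1 p.2 (by
      have := hp.2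
      rintro h0
      simp [h0] at this)
    refine ⟨hess φ p.1 p.2 / 2, by positivity, fun z hz h hh => ?_⟩
    have : hess φ p.1 p.2 ≤ hess φ z h := hmin (show (z, h) ∈ W ×ˢ _ from ⟨hz, hh⟩)
    linarith
  obtain ⟨R, hR0, hR⟩ : ∃ R > (0 : ℝ), ∀ z ∈ W, ‖z‖ < R := by
    obtain ⟨R, hR⟩ := hbdd.exists_norm_le
    exact ⟨|R| + 1, by positivity, fun z hz => by linarith [hR z hz, le_abs_self R]⟩
  set V : Set (E) := Metric.ball 0 R ∩
    {z | ∀ h ∈ Metric.sphere (0 : E) 1, m < hess φ z h} with hVd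
  have hVo : IsOpen V := Metric.isOpen_ball.inter
    (isOpen_forall_compact hsph (isOpen_lt continuous_const (continuous_hess hφ)))
  have hWV : W ⊆ V := fun z hz => ⟨by simpa using hR z hz, hm z hz⟩
  have hVl : ∀ z ∈ V, ∀ h, m * ‖h‖ ^ 2 ≤ hess φ z h := fun z hz h => hess_lower hz.2 h
  have hWx : Convex ℝ W := sublevel_convex hφ hWpre hVo hWV
    (fun z hz h => le_trans (by positivity) (hVl z hz h))
  obtain ⟨ψ, c, hc, hψ, hψ2, hψ0, hψW, hψp, hψl⟩ :=
    barrier_compl hWcl hWx hR0 (fun z hz => (hR z hz).le) hVo hWV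
  -- cutoff
  obtain ⟨χ, hχR⟩ : ∃ χ : ContDiffBump (0 : E), χ.rIn = R :=
    ⟨⟨R, R + 1, hR0, by linarith⟩, rfl⟩
  set G : E → ℝ := fun z => χ z * φ z with hGd
  have hG : ContDiff ℝ (⊤ : ℕ∞) G := χ.contDiff.mul hφ
  have hGs : HasCompactSupport G := χ.hasCompactSupport.mul_right
  have hGball : ∀ z ∈ Metric.ball (0 : E) R, G z = φ z := by
    intro z hz
    have : χ z = 1 := χ.one_of_mem_closedBall (by rw [hχR]; exact Metric.ball_subset_closedBall hz)
    simp [hGd, this]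
  have hGV : ∀ z ∈ V, ∀ h, hess G z h = hess φ z h := by
    intro z hz h
    have e : G =ᶠ[nhds z] φ := by
      filter_upwards [Metric.isOpen_ball.mem_nhds hz.1] with w hw using hGball w hw
    simp only [hess]
    rw [e.fderiv.fderiv_eq]
  obtain ⟨M, hM0, hGl⟩ := hess_bound hG hGs
  set K := (M + m) / c with hK
  have hK0 : 0 < K := by positivity
  have hKc : K * c = M + m := by rw [hK]; field_simp
  have hC : ContDiff ℝ (⊤ : ℕ∞) (fun z => 1 + G z + K * ψ z) := by fun_prop
  have hCl : ∀ z h, m * ‖h‖ ^ 2 ≤ hess (fun z => 1 + G z + K * ψ z) z h := by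
    intro z h
    rw [hess_add hG hψ]
    by_cases hz : z ∈ V
    · rw [hGV z hz]
      have := mul_nonneg hK0.le (hψ2 z h)
      linarith [hVl z hz h]
    · have h1 := mul_le_mul_of_nonneg_left (hψl z hz h) hK0.le
      rw [← mul_assoc, hKc] at h1
      linarith [hGl z h]
  refine ⟨m / 2, by positivity, fun z => 1 + G z + K * ψ z, hC,
    convexOn_of_hess hC (fun z h => le_trans (by positivity) (hCl z h)), ?_, ?_⟩
  · ext z
    simp only [Set.mem_preimage, Set.mem_singleton_iff]
    by_cases hz : z ∈ W
    · rw [hψW z hz, hGball z (hWV hz).1]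
      constructor <;> intro h <;> linarith
    · have hφz : 0 < φ z := not_le.1 hz
      have h1 : 0 ≤ G z := mul_nonneg χ.nonneg hφz.le
      have h2 := mul_nonneg hK0.le (hψ0 z)
      refine ⟨fun h => absurd h hφz.ne', fun h => absurd h (ne_of_gt ?_)⟩
      by_cases hzV : z ∈ V
      · rw [hGball z hzV.1]; linarith
      · have := mul_pos hK0 (hψp z hzV)
        linarith
  · intro z h h0
    have hn : 0 < ‖h‖ := norm_pos_iff.2 h0
    refine lt_of_lt_of_le ?_ (hCl z h)
    have : 0 < m * ‖h‖ ^ 2 := by positivity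
    linarith

end Helpers

/-- A compact connected regular level set of a function with positive definite
Hessian on the sublevel set bounds a strongly convex domain. -/
theorem bounds_strongly_convex_domain
    (S : Set (EuclideanSpace ℝ (Fin 4)))
    (hScomp : IsCompact S) (hSconn : IsConnected S)
    (φ : EuclideanSpace ℝ (Fin 4) → ℝ) (hφ : ContDiff ℝ (⊤ : ℕ∞) φ)
    (hlevel : S = φ ⁻¹' {0})
    (hreg : ∀ z ∈ S, fderiv ℝ φ z ≠ 0)
    (hbdd : Bornology.IsBounded {z | φ z ≤ 0})
    (hconv : ∀ z, φ z ≤ 0 → ∀ h : EuclideanSpace ℝ (Fin 4), h ≠ 0 →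
      0 < fderiv ℝ (fderiv ℝ φ) z h h) :
    ∃ δ > (0 : ℝ), ∃ C : EuclideanSpace ℝ (Fin 4) → ℝ,
      ContDiff ℝ (⊤ : ℕ∞) C ∧ ConvexOn ℝ Set.univ C ∧ S = C ⁻¹' {1} ∧
      ∀ z, ∀ h : EuclideanSpace ℝ (Fin 4), h ≠ 0 →
        δ * ‖h‖ ^ 2 < fderiv ℝ (fderiv ℝ C) z h h := by
  subst hlevel
  exact main_aux hφ hSconn hbdd hconv
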